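/- arXiv:2508.14757 — 2 statements merged into one kernel-verified Lean document; each statement's English description precedes it below -/
import Mathlib

section
/- Let p, q ∈ (1, ∞) be conjugate exponents (1/p + 1/q = 1). Let ‖·‖ be a norm on ℝ^k with dual norm ‖y‖_* = sup_{‖x‖ ≤ 1} ⟨x, y⟩, and let h : ℝ^k → ℝ^k satisfy ⟨h(y), y⟩ = ‖y‖_* for all y and ‖h(y)‖ = 1 for all y ≠ 0. Let l : ℝ^k → ℝ be Lipschitz continuous and continuously differentiable. Let X_1, …, X_N ∈ ℝ^k, let μ = (1/N) Σ_{n=1}^N δ_{X_n}, and assume Υ := ((1/N) Σ_{n=1}^N ‖∇l(X_n)‖_*^q)^{1/q} > 0. For δ ≥ 0 define the perturbed points X̂_n(δ) = X_n + δ · h(∇l(X_n)) ‖∇l(X_n)‖_*^{q−1} Υ^{1−q} and V(δ) = sup { ∫ l dη : η a probability measure on ℝ^k with W_p(μ, η) ≤ δ }. Then V(δ) = (1/N) Σ_{n=1}^N l(X̂_n(δ)) + o(δ) as δ ↓ 0, i.e. lim_{δ → 0+} (V(δ) − (1/N) Σ_{n=1}^N l(X̂_n(δ)))/δ = 0. 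-/
open MeasureTheory Filter
open scoped ENNReal NNReal

noncomputable section

/-- The standard inner product pairing on `ℝ^k`. -/
def pairing {k : ℕ} (x y : Fin k → ℝ) : ℝ := ∑ i, x i * y i

/-- `nrm` is a norm on `ℝ^k`. -/
structure IsNorm {k : ℕ} (nrm : (Fin k → ℝ) → ℝ) : Prop where
  triangle : ∀ x y, nrm (x + y) ≤ nrm x + nrm y
  smul : ∀ (c : ℝ) (x : Fin k → ℝ), nrm (c • x) = |c| * nrm x
  pos : ∀ x, x ≠ 0 → 0 < nrm x

/-- The dual norm `‖y‖_* = sup_{‖x‖ ≤ 1} ⟨x, y⟩`. -/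
def dualNorm {k : ℕ} (nrm : (Fin k → ℝ) → ℝ) (y : Fin k → ℝ) : ℝ :=
  sSup {r | ∃ x, nrm x ≤ 1 ∧ r = pairing x y}

/-- The gradient of `l : ℝ^k → ℝ` with respect to the standard basis. -/
def grad {k : ℕ} (l : (Fin k → ℝ) → ℝ) (x : Fin k → ℝ) : Fin k → ℝ :=
  fun i => fderiv ℝ l x (Pi.single i 1)

/-- The `p`-Wasserstein distance (with respect to the norm `nrm`), as an
infimum over all couplings of `μ` and `ν`. -/
def Wp {k : ℕ} (p : ℝ) (nrm : (Fin k → ℝ) → ℝ) (μ ν : Measure (Fin k → ℝ)) : ℝ≥0∞ :=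
  ⨅ (π : Measure ((Fin k → ℝ) × (Fin k → ℝ))) (_ : IsProbabilityMeasure π)
    (_ : π.map Prod.fst = μ) (_ : π.map Prod.snd = ν),
    (∫⁻ z, ENNReal.ofReal (nrm (z.1 - z.2) ^ p) ∂π) ^ (1 / p)

/-- The robust value `V(δ) = sup { ∫ l dη : W_p(μ, η) ≤ δ }`. -/
def Vrob {k : ℕ} (p : ℝ) (nrm : (Fin k → ℝ) → ℝ) (l : (Fin k → ℝ) → ℝ)
    (μ : Measure (Fin k → ℝ)) (δ : ℝ) : ℝ :=
  sSup {r | ∃ η : Measure (Fin k → ℝ), IsProbabilityMeasure η ∧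
    Wp p nrm μ η ≤ ENNReal.ofReal δ ∧ r = ∫ x, l x ∂η}

namespace IsNorm

variable {k : ℕ} {nrm : (Fin k → ℝ) → ℝ}

lemma map_zero (hn : IsNorm nrm) : nrm 0 = 0 := by
  simpa using hn.smul 0 0

lemma map_neg (hn : IsNorm nrm) (x : Fin k → ℝ) : nrm (-x) = nrm x := by
  simpa using hn.smul (-1) x

lemma map_sub_rev (hn : IsNorm nrm) (x y : Fin k → ℝ) : nrm (x - y) = nrm (y - x) := by
  rw [← hn.map_neg, neg_sub]

lemma nonneg (hn : IsNorm nrm) (x : Fin k → ℝ) : 0 ≤ nrm x := by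
  rcases eq_or_ne x 0 with rfl | hx
  · exact hn.map_zero.ge
  · exact (hn.pos x hx).le

lemma map_sum_le (hn : IsNorm nrm) {ι : Type*} (s : Finset ι) (f : ι → Fin k → ℝ) :
    nrm (∑ i ∈ s, f i) ≤ ∑ i ∈ s, nrm (f i) :=
  Finset.le_sum_of_subadditive nrm hn.map_zero.le hn.triangle s f

lemma exists_le_mul_norm (hn : IsNorm nrm) : ∃ A, 0 < A ∧ ∀ x, nrm x ≤ A * ‖x‖ := by
  refine ⟨∑ i, nrm (Pi.single i 1) + 1,
    add_pos_of_nonneg_of_pos (Finset.sum_nonneg fun i _ => hn.nonneg _) one_pos, fun x => ?_⟩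
  have hx : x = ∑ i, x i • (Pi.single i 1 : Fin k → ℝ) := by
    simpa using (pi_eq_sum_univ' x)
  calc nrm x ≤ ∑ i, nrm (x i • (Pi.single i 1 : Fin k → ℝ)) := by
        conv_lhs => rw [hx]
        exact hn.map_sum_le _ _
    _ ≤ ∑ i, ‖x‖ * nrm (Pi.single i 1) := by
        refine Finset.sum_le_sum fun i _ => ?_
        rw [hn.smul]
        exact mul_le_mul_of_nonneg_right (norm_le_pi_norm x i) (hn.nonneg _)
    _ ≤ _ := by
        rw [← Finset.mul_sum]
        nlinarith [norm_nonneg x]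

lemma continuous (hn : IsNorm nrm) : Continuous nrm := by
  obtain ⟨A, hA, h⟩ := hn.exists_le_mul_norm
  refine (LipschitzWith.of_le_add_mul A.toNNReal fun x y => ?_).continuous
  rw [Real.coe_toNNReal _ hA.le, dist_eq_norm]
  have := hn.triangle y (x - y)
  rw [add_sub_cancel] at this
  linarith [h (x - y)]

lemma exists_norm_le_mul (hn : IsNorm nrm) : ∃ B, 0 < B ∧ ∀ x, ‖x‖ ≤ B * nrm x := by
  rcases (Metric.sphere (0 : Fin k → ℝ) 1).eq_empty_or_nonempty with he | hne
  · refine ⟨1, one_pos, fun x => ?_⟩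
    rcases eq_or_ne x 0 with rfl | hx
    · simp [hn.map_zero]
    · have : ‖x‖⁻¹ • x ∈ Metric.sphere (0 : Fin k → ℝ) 1 := by
        simp [norm_smul, norm_ne_zero_iff.2 hx]
      simp [he] at this
  · obtain ⟨z, hz, hmin⟩ := (isCompact_sphere (0 : Fin k → ℝ) 1).exists_isMinOn hne
      hn.continuous.continuousOn
    have hz0 : z ≠ 0 := by
      rintro rfl
      simp at hz
    have hpos := hn.pos z hz0
    refine ⟨(nrm z)⁻¹, inv_pos.2 hpos, fun x => ?_⟩
    rcases eq_or_ne x 0 with rfl | hx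
    · simp [hn.map_zero]
    · have hmem : ‖x‖⁻¹ • x ∈ Metric.sphere (0 : Fin k → ℝ) 1 := by
        simp [norm_smul, norm_ne_zero_iff.2 hx]
      have h1 : nrm z ≤ nrm (‖x‖⁻¹ • x) := hmin hmem
      have hx' : 0 < ‖x‖ := norm_pos_iff.2 hx
      rw [hn.smul, abs_of_pos (inv_pos.2 hx'), inv_mul_eq_div, le_div_iff₀ hx'] at h1
      rwa [inv_mul_eq_div, le_div_iff₀ hpos, mul_comm]

lemma bddAbove_pairing (hn : IsNorm nrm) (y : Fin k → ℝ) :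
    BddAbove {r | ∃ x, nrm x ≤ 1 ∧ r = pairing x y} := by
  obtain ⟨B, hB, h⟩ := hn.exists_norm_le_mul
  refine ⟨∑ i, B * |y i|, ?_⟩
  rintro r ⟨x, hx, rfl⟩
  refine Finset.sum_le_sum fun i _ => ?_
  have h1 : |x i| ≤ B := (norm_le_pi_norm x i).trans ((h x).trans (by nlinarith))
  calc x i * y i ≤ |x i| * |y i| := by rw [← abs_mul]; exact le_abs_self _
    _ ≤ B * |y i| := by gcongr

lemma dualNorm_nonneg (hn : IsNorm nrm) (y : Fin k → ℝ) : 0 ≤ dualNorm nrm y :=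
  le_csSup (hn.bddAbove_pairing y) ⟨0, by simp [hn.map_zero], by simp [pairing]⟩

lemma pairing_le (hn : IsNorm nrm) (x y : Fin k → ℝ) :
    pairing x y ≤ dualNorm nrm y * nrm x := by
  rcases eq_or_ne x 0 with rfl | hx
  · simp [pairing, hn.map_zero]
  · have hpos := hn.pos x hx
    have h1 : pairing ((nrm x)⁻¹ • x) y ≤ dualNorm nrm y := by
      refine le_csSup (hn.bddAbove_pairing y) ⟨_, ?_, rfl⟩
      rw [hn.smul, abs_of_pos (inv_pos.2 hpos), inv_mul_cancel₀ hpos.ne']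
    have h2 : pairing ((nrm x)⁻¹ • x) y = pairing x y / nrm x := by
      simp [pairing, Finset.mul_sum, div_eq_inv_mul, mul_assoc]
    rwa [h2, div_le_iff₀ hpos] at h1

lemma dualNorm_zero (hn : IsNorm nrm) : dualNorm nrm 0 = 0 := by
  refine le_antisymm (Real.sSup_nonpos ?_) (hn.dualNorm_nonneg 0)
  rintro r ⟨x, -, rfl⟩
  simp [pairing]

end IsNorm

lemma fderiv_apply_eq_pairing {k : ℕ} (l : (Fin k → ℝ) → ℝ) (x v : Fin k → ℝ) :
    fderiv ℝ l x v = pairing v (grad l x) := by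
  have hv : v = ∑ i, v i • (Pi.single i 1 : Fin k → ℝ) := by
    simpa using (pi_eq_sum_univ' v)
  conv_lhs => rw [hv]
  simp [pairing, grad, map_sum]

/-- A differentiable Lipschitz function grows from `x` at most like its linearization, up to an
arbitrarily small linear term and a multiple of the `p`-th power of the distance. -/
lemma exists_sub_le_rpow {k : ℕ} {p : ℝ} (hp : 1 ≤ p) {nrm : (Fin k → ℝ) → ℝ} (hn : IsNorm nrm)
    {l : (Fin k → ℝ) → ℝ} {K : ℝ≥0} (hlip : LipschitzWith K l) {x : Fin k → ℝ}
    (hd : DifferentiableAt ℝ l x) {ε : ℝ} (hε : 0 < ε) :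
    ∃ C, 0 ≤ C ∧ ∀ y, l y - l x ≤
      dualNorm nrm (grad l x) * nrm (x - y) + ε * nrm (x - y) + C * nrm (x - y) ^ p := by
  obtain ⟨A, hA, hnA⟩ := hn.exists_le_mul_norm
  obtain ⟨B, hB, hnB⟩ := hn.exists_norm_le_mul
  have ho := (hasFDerivAt_iff_isLittleO.1 hd.hasFDerivAt).bound (div_pos hε hB)
  obtain ⟨r, hr, hball⟩ := Metric.eventually_nhds_iff.1 ho
  have hs : 0 < r / B := div_pos hr hB
  refine ⟨K * B * (r / B) * (1 / (r / B)) ^ p, by positivity, fun y => ?_⟩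
  have hdn := hn.nonneg (x - y)
  have hg := mul_nonneg (hn.dualNorm_nonneg (grad l x)) hdn
  have hnorm : ‖y - x‖ ≤ B * nrm (x - y) := hn.map_sub_rev x y ▸ hnB (y - x)
  by_cases hy : dist y x < r
  · have h1 := (le_abs_self _).trans (hball hy)
    rw [fderiv_apply_eq_pairing] at h1
    have h2 := hn.pairing_le (y - x) (grad l x)
    rw [hn.map_sub_rev] at h2
    have h3 : ε / B * ‖y - x‖ ≤ ε * nrm (x - y) := by
      calc ε / B * ‖y - x‖ ≤ ε / B * (B * nrm (x - y)) := by gcongr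
        _ = ε * nrm (x - y) := by field_simp
    have : 0 ≤ K * B * (r / B) * (1 / (r / B)) ^ p * nrm (x - y) ^ p := by positivity
    linarith
  · have h1 : l y - l x ≤ K * ‖y - x‖ := by
      have := hlip.dist_le_mul y x
      rw [Real.dist_eq, dist_eq_norm] at this
      exact (le_abs_self _).trans this
    have h2 : r / B ≤ nrm (x - y) := by
      rw [div_le_iff₀ hB, mul_comm]
      rw [dist_eq_norm] at hy
      linarith
    have h3 : nrm (x - y) ≤ r / B * ((1 / (r / B)) ^ p * nrm (x - y) ^ p) := by
      rw [← Real.mul_rpow (by positivity) hdn, one_div_mul_eq_div]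
      have h4 : 1 ≤ nrm (x - y) / (r / B) := (one_le_div hs).2 h2
      calc nrm (x - y) = r / B * (nrm (x - y) / (r / B)) := by field_simp
        _ ≤ r / B * (nrm (x - y) / (r / B)) ^ p := by
          gcongr
          exact Real.self_le_rpow_of_one_le h4 hp
    have h5 : l y - l x ≤ K * B * (r / B) * (1 / (r / B)) ^ p * nrm (x - y) ^ p := by
      calc l y - l x ≤ K * (B * nrm (x - y)) := h1.trans (by gcongr)
        _ ≤ K * (B * (r / B * ((1 / (r / B)) ^ p * nrm (x - y) ^ p))) := by gcongr
        _ = _ := by ring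
    have := mul_nonneg hε.le hdn
    linarith

/-- Weak duality: a majorant `F x + c ‖x - y‖ ^ p` of `l y` bounds `∫ l` over the
Wasserstein ball. -/
lemma integral_le_of_Wp_le {k : ℕ} {p : ℝ} (hp : 0 < p) {nrm : (Fin k → ℝ) → ℝ} (hn : IsNorm nrm)
    {l F G : (Fin k → ℝ) → ℝ} (hl : Continuous l) {c c' : ℝ} (hc : 0 ≤ c)
    {μ η : Measure (Fin k → ℝ)} (hF : Integrable F μ) (hG : Integrable G μ)
    (hlF : ∀ᵐ x ∂μ, ∀ y, l y ≤ F x + c * nrm (x - y) ^ p)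
    (hlG : ∀ᵐ x ∂μ, ∀ y, |l y| ≤ G x + c' * nrm (x - y) ^ p)
    {δ : ℝ} (hδ : 0 ≤ δ) (hW : Wp p nrm μ η ≤ ENNReal.ofReal δ) :
    ∫ y, l y ∂η ≤ ∫ x, F x ∂μ + c * δ ^ p := by
  have key : ∀ δ' > δ, ∫ y, l y ∂η ≤ ∫ x, F x ∂μ + c * δ' ^ p := by
    intro δ' hδ'
    have hδ'0 : 0 < δ' := hδ.trans_lt hδ'
    have hlt : Wp p nrm μ η < ENNReal.ofReal δ' :=
      hW.trans_lt ((ENNReal.ofReal_lt_ofReal_iff hδ'0).2 hδ')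
    simp only [Wp, iInf_lt_iff] at hlt
    obtain ⟨π, _, hfst, hsnd, hcost⟩ := hlt
    have hmeas : Continuous fun z : (Fin k → ℝ) × (Fin k → ℝ) => nrm (z.1 - z.2) ^ p :=
      (hn.continuous.comp (continuous_fst.sub continuous_snd)).rpow_const fun _ => Or.inr hp.le
    have hnn : ∀ z : (Fin k → ℝ) × (Fin k → ℝ), 0 ≤ nrm (z.1 - z.2) ^ p :=
      fun z => Real.rpow_nonneg (hn.nonneg _) _
    have hcost' : ∫⁻ z, ENNReal.ofReal (nrm (z.1 - z.2) ^ p) ∂π ≤ ENNReal.ofReal (δ' ^ p) := by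
      rw [← ENNReal.ofReal_rpow_of_pos hδ'0]
      have := ENNReal.rpow_le_rpow hcost.le hp.le
      rwa [← ENNReal.rpow_mul, one_div_mul_cancel hp.ne', ENNReal.rpow_one] at this
    have hint : Integrable (fun z => nrm (z.1 - z.2) ^ p) π :=
      (lintegral_ofReal_ne_top_iff_integrable hmeas.aestronglyMeasurable (ae_of_all _ hnn)).1
        (hcost'.trans_lt ENNReal.ofReal_lt_top).ne
    have hle : ∫ z, nrm (z.1 - z.2) ^ p ∂π ≤ δ' ^ p := by
      rw [← ofReal_integral_eq_lintegral_ofReal hint (ae_of_all _ hnn)] at hcost'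
      exact (ENNReal.ofReal_le_ofReal_iff (by positivity)).1 hcost'
    have hF' : Integrable (fun z => F z.1) π :=
      (hfst.symm ▸ hF : Integrable F (π.map Prod.fst)).comp_measurable measurable_fst
    have hG' : Integrable (fun z => G z.1) π :=
      (hfst.symm ▸ hG : Integrable G (π.map Prod.fst)).comp_measurable measurable_fst
    have hlF' : ∀ᵐ z ∂π, l z.2 ≤ F z.1 + c * nrm (z.1 - z.2) ^ p := by
      rw [← hfst] at hlF
      filter_upwards [ae_of_ae_map measurable_fst.aemeasurable hlF] with z hz using hz z.2
    have hlG' : ∀ᵐ z ∂π, ‖l z.2‖ ≤ G z.1 + c' * nrm (z.1 - z.2) ^ p := by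
      rw [← hfst] at hlG
      filter_upwards [ae_of_ae_map measurable_fst.aemeasurable hlG] with z hz using hz z.2
    have hl' : Integrable (fun z => l z.2) π :=
      (hG'.add (hint.const_mul c')).mono' (hl.comp continuous_snd).aestronglyMeasurable hlG'
    calc ∫ y, l y ∂η = ∫ z, l z.2 ∂π := by
          rw [← hsnd, integral_map measurable_snd.aemeasurable hl.aestronglyMeasurable]
      _ ≤ ∫ z, (F z.1 + c * nrm (z.1 - z.2) ^ p) ∂π :=
          integral_mono_ae hl' (hF'.add (hint.const_mul c)) hlF'
      _ = ∫ z, F z.1 ∂π + c * ∫ z, nrm (z.1 - z.2) ^ p ∂π := by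
          rw [integral_add hF' (hint.const_mul c), integral_const_mul]
      _ = ∫ x, F x ∂μ + c * ∫ z, nrm (z.1 - z.2) ^ p ∂π := by
          subst hfst
          rw [integral_map measurable_fst.aemeasurable hF.aestronglyMeasurable]
      _ ≤ _ := by gcongr
  have hlim : Tendsto (fun δ' : ℝ => ∫ x, F x ∂μ + c * δ' ^ p) (nhdsWithin δ (Set.Ioi δ))
      (nhds (∫ x, F x ∂μ + c * δ ^ p)) := by
    have : ContinuousAt (fun δ' : ℝ => ∫ x, F x ∂μ + c * δ' ^ p) δ :=
      continuousAt_const.add (continuousAt_const.mul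
        (Real.continuousAt_rpow_const _ _ (Or.inr hp.le)))
    exact this.tendsto.mono_left nhdsWithin_le_nhds
  exact ge_of_tendsto hlim (eventually_nhdsWithin_of_forall key)

section Empirical

variable {α : Type*} [MeasurableSpace α] {N : ℕ}

lemma isProbabilityMeasure_empirical (hN : 0 < N) (Y : Fin N → α) :
    IsProbabilityMeasure ((N : ℝ≥0∞)⁻¹ • ∑ n, Measure.dirac (Y n)) := by
  constructor
  simpa using ENNReal.inv_mul_cancel (by simpa using hN.ne') (by simp)

lemma map_empirical {β : Type*} [MeasurableSpace β] {f : α → β} (hf : Measurable f)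
    (Y : Fin N → α) :
    ((N : ℝ≥0∞)⁻¹ • ∑ n, Measure.dirac (Y n)).map f =
      (N : ℝ≥0∞)⁻¹ • ∑ n, Measure.dirac (f (Y n)) := by
  rw [Measure.map_smul, Measure.map_finset_sum' hf.aemeasurable]
  simp_rw [Measure.map_dirac' hf]

variable [MeasurableSingletonClass α]

lemma integrable_empirical (hN : 0 < N) (Y : Fin N → α) (f : α → ℝ) :
    Integrable f ((N : ℝ≥0∞)⁻¹ • ∑ n, Measure.dirac (Y n)) :=
  (integrable_finsetSum_measure.2 fun _ _ => integrable_dirac (by simp)).smul_measure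
    (by simpa using hN.ne')

lemma integral_empirical (Y : Fin N → α) (f : α → ℝ) :
    ∫ x, f x ∂((N : ℝ≥0∞)⁻¹ • ∑ n, Measure.dirac (Y n)) = 1 / (N : ℝ) * ∑ n, f (Y n) := by
  rw [integral_smul_measure, integral_finsetSum_measure fun _ _ => integrable_dirac (by simp)]
  simp

lemma ae_empirical {P : α → Prop} {Y : Fin N → α} (hP : ∀ n, P (Y n)) :
    ∀ᵐ x ∂((N : ℝ≥0∞)⁻¹ • ∑ n, Measure.dirac (Y n)), P x := by
  refine Measure.ae_smul_measure ?_ _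
  rw [← Measure.sum_fintype, Measure.ae_sum_iff]
  intro n
  rw [ae_dirac_eq]
  exact hP n

end Empirical

/-- Moving each atom of an empirical measure gives an upper bound on the Wasserstein distance. -/
lemma Wp_empirical_le {k N : ℕ} (hN : 0 < N) {p : ℝ} (hp : 0 < p) {nrm : (Fin k → ℝ) → ℝ}
    (hn : IsNorm nrm) (X Y : Fin N → Fin k → ℝ) :
    Wp p nrm ((N : ℝ≥0∞)⁻¹ • ∑ n, Measure.dirac (X n))
        ((N : ℝ≥0∞)⁻¹ • ∑ n, Measure.dirac (Y n)) ≤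
      ENNReal.ofReal ((1 / (N : ℝ) * ∑ n, nrm (X n - Y n) ^ p) ^ (1 / p)) := by
  refine iInf_le_of_le ((N : ℝ≥0∞)⁻¹ • ∑ n, Measure.dirac (X n, Y n)) <|
    iInf_le_of_le (isProbabilityMeasure_empirical hN _) <|
    iInf_le_of_le (map_empirical measurable_fst _) <|
    iInf_le_of_le (map_empirical measurable_snd _) ?_
  have hnn : ∀ z : (Fin k → ℝ) × (Fin k → ℝ), 0 ≤ nrm (z.1 - z.2) ^ p :=
    fun z => Real.rpow_nonneg (hn.nonneg _) _
  rw [← ofReal_integral_eq_lintegral_ofReal (integrable_empirical hN _ _) (ae_of_all _ hnn),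
    integral_empirical, ENNReal.ofReal_rpow_of_nonneg _ (by positivity)]
  exact mul_nonneg (by positivity) (Finset.sum_nonneg fun n _ => hnn (X n, Y n))

/-- First-order upper bound for the integral of `l` over a Wasserstein ball around an
empirical measure. -/
lemma exists_integral_le_of_Wp_le {k N : ℕ} (hN : 0 < N) {p q : ℝ} (hpq : p.HolderConjugate q)
    {nrm : (Fin k → ℝ) → ℝ} (hn : IsNorm nrm) {l : (Fin k → ℝ) → ℝ} {K : ℝ≥0}
    (hlip : LipschitzWith K l) (hd : Differentiable ℝ l) (X : Fin N → Fin k → ℝ)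
    {Υ : ℝ} (hΥpos : 0 < Υ)
    (hΥ : 1 / (N : ℝ) * ∑ n, dualNorm nrm (grad l (X n)) ^ q = Υ ^ q) {ε : ℝ} (hε : 0 < ε) :
    ∃ C, ∀ δ > 0, ∀ η : Measure (Fin k → ℝ),
      Wp p nrm ((N : ℝ≥0∞)⁻¹ • ∑ n, Measure.dirac (X n)) η ≤ ENNReal.ofReal δ →
      ∫ y, l y ∂η ≤ 1 / (N : ℝ) * ∑ n, l (X n) + (Υ + ε) * δ + C * δ ^ p := by
  have hp := hpq.lt
  have hp0 := hpq.pos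
  have hq0 := hpq.symm.pos
  have hN' : (N : ℝ) ≠ 0 := by exact_mod_cast hN.ne'
  obtain ⟨B, hB, hnB⟩ := hn.exists_norm_le_mul
  choose C hC0 hC using fun n => exists_sub_le_rpow hp.le hn hlip (hd (X n)) hε
  refine ⟨∑ n, C n, fun δ hδ η hW => ?_⟩
  have hC0' : 0 ≤ ∑ n, C n := Finset.sum_nonneg fun n _ => hC0 n
  have hδp : 0 < δ ^ p := Real.rpow_pos_of_pos hδ p
  have hbound := integral_le_of_Wp_le hp0 hn hlip.continuous
    (F := fun x => l x + Υ * δ * ((dualNorm nrm (grad l x) / Υ) ^ q / q) + ε * δ / q)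
    (G := fun x => |l x| + K * B) (c := (Υ + ε) * δ / (p * δ ^ p) + ∑ n, C n) (c' := K * B)
    (by positivity) (integrable_empirical hN X _) (integrable_empirical hN X _)
    (ae_empirical fun n y => ?_) (ae_empirical fun n y => ?_) hδ.le hW
  · rw [integral_empirical] at hbound
    refine hbound.trans_eq ?_
    have hsum : 1 / (N : ℝ) * ∑ n, (dualNorm nrm (grad l (X n)) / Υ) ^ q = 1 := by
      simp_rw [Real.div_rpow (hn.dualNorm_nonneg _) hΥpos.le, ← Finset.sum_div]
      rw [← mul_div_assoc, hΥ, div_self (by positivity)]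
    have hF : 1 / (N : ℝ) * ∑ n, (l (X n) +
        Υ * δ * ((dualNorm nrm (grad l (X n)) / Υ) ^ q / q) + ε * δ / q) =
        1 / (N : ℝ) * ∑ n, l (X n) + (Υ + ε) * δ * q⁻¹ := by
      rw [Finset.sum_add_distrib, Finset.sum_add_distrib, ← Finset.mul_sum, ← Finset.sum_div]
      have h1 : 1 / (N : ℝ) * ∑ _n : Fin N, ε * δ / q = ε * δ * q⁻¹ := by
        simp
        field_simp
      calc _ = 1 / (N : ℝ) * ∑ n, l (X n) + Υ * δ * q⁻¹ *
            (1 / (N : ℝ) * ∑ n, (dualNorm nrm (grad l (X n)) / Υ) ^ q) +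
            1 / (N : ℝ) * ∑ _n : Fin N, ε * δ / q := by ring
        _ = _ := by rw [hsum, h1]; ring
    have h2 : ((Υ + ε) * δ / (p * δ ^ p) + ∑ n, C n) * δ ^ p =
        (Υ + ε) * δ * p⁻¹ + (∑ n, C n) * δ ^ p := by
      field_simp
    rw [hF, h2]
    linear_combination (Υ + ε) * δ * hpq.inv_add_inv_eq_one
  · set d := nrm (X n - y) with hdd
    set g := dualNorm nrm (grad l (X n)) with hg
    have hd0 : 0 ≤ d := hn.nonneg _
    have hg0 : 0 ≤ g := hn.dualNorm_nonneg _
    have y1 := Real.young_inequality_of_nonneg (div_nonneg hd0 hδ.le) (div_nonneg hg0 hΥpos.le) hpq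
    have y2 := Real.young_inequality_of_nonneg (div_nonneg hd0 hδ.le) zero_le_one hpq
    rw [Real.div_rpow hd0 hδ.le] at y1 y2
    rw [Real.one_rpow] at y2
    have z1 : g * d ≤ Υ * δ * (d ^ p / δ ^ p / p + (g / Υ) ^ q / q) := by
      calc g * d = Υ * δ * (d / δ * (g / Υ)) := by field_simp
        _ ≤ _ := by gcongr
    have z2 : ε * d ≤ ε * δ * (d ^ p / δ ^ p / p + 1 / q) := by
      calc ε * d = ε * δ * (d / δ * 1) := by field_simp
        _ ≤ _ := by gcongr
    have z3 : C n * d ^ p ≤ (∑ n, C n) * d ^ p := by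
      gcongr
      exact Finset.single_le_sum (fun i _ => hC0 i) (Finset.mem_univ n)
    have z4 : ((Υ + ε) * δ / (p * δ ^ p) + ∑ n, C n) * d ^ p =
        Υ * δ * (d ^ p / δ ^ p / p) + ε * δ * (d ^ p / δ ^ p / p) + (∑ n, C n) * d ^ p := by
      field_simp
    have z5 : ε * δ / q = ε * δ * (1 / q) := by ring
    rw [z4, z5]
    have := hC n y
    linarith
  · have hd0 : 0 ≤ nrm (X n - y) := hn.nonneg _
    have h1 : |l y| ≤ |l (X n)| + K * (B * nrm (X n - y)) := by
      have h2 := hlip.dist_le_mul (X n) y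
      rw [Real.dist_eq, dist_eq_norm] at h2
      have h3 := abs_sub_abs_le_abs_sub (l y) (l (X n))
      rw [abs_sub_comm] at h3
      have h4 : (K : ℝ) * ‖X n - y‖ ≤ K * (B * nrm (X n - y)) := by
        gcongr
        exact hnB _
      linarith
    have h5 : nrm (X n - y) ≤ 1 + nrm (X n - y) ^ p := by
      rcases le_total (nrm (X n - y)) 1 with h | h
      · linarith [Real.rpow_nonneg hd0 p]
      · linarith [Real.self_le_rpow_of_one_le h hp.le]
    have h6 : (K : ℝ) * (B * nrm (X n - y)) ≤ K * (B * (1 + nrm (X n - y) ^ p)) := by gcongr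
    linarith

theorem stmt0 {k : ℕ} (p q : ℝ) (hp : 1 < p) (hq : 1 < q) (hpq : 1 / p + 1 / q = 1)
    (nrm : (Fin k → ℝ) → ℝ) (hnrm : IsNorm nrm)
    (h : (Fin k → ℝ) → (Fin k → ℝ))
    (hdual : ∀ y, pairing (h y) y = dualNorm nrm y)
    (hunit : ∀ y, y ≠ 0 → nrm (h y) = 1)
    (l : (Fin k → ℝ) → ℝ) (hlip : ∃ K : ℝ≥0, LipschitzWith K l)
    (hsmooth : ContDiff ℝ 1 l)
    (N : ℕ) (hN : 0 < N) (X : Fin N → Fin k → ℝ)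
    (μ : Measure (Fin k → ℝ))
    (hμ : μ = (N : ℝ≥0∞)⁻¹ • ∑ n, Measure.dirac (X n))
    (Υ : ℝ)
    (hΥ : Υ = ((1 / (N : ℝ)) * ∑ n, dualNorm nrm (grad l (X n)) ^ q) ^ (1 / q))
    (hΥpos : 0 < Υ)
    (Xhat : ℝ → Fin N → Fin k → ℝ)
    (hXhat : ∀ δ n, Xhat δ n =
      X n + (δ * dualNorm nrm (grad l (X n)) ^ (q - 1) * Υ ^ (1 - q)) • h (grad l (X n))) :
    Tendsto (fun δ : ℝ =>
        (Vrob p nrm l μ δ - (1 / (N : ℝ)) * ∑ n, l (Xhat δ n)) / δ)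
      (nhdsWithin 0 (Set.Ioi 0)) (nhds 0) := by
  obtain ⟨K, hlip⟩ := hlip
  have hpq' : p.HolderConjugate q :=
    Real.holderConjugate_iff.2 ⟨hp, by simpa only [one_div] using hpq⟩
  have hp0 := hpq'.pos
  have hq0 := hpq'.symm.pos
  have hd : Differentiable ℝ l := hsmooth.differentiable (by norm_num)
  have hg0 : ∀ n, 0 ≤ dualNorm nrm (grad l (X n)) := fun n => hnrm.dualNorm_nonneg _
  have hΥq : 1 / (N : ℝ) * ∑ n, dualNorm nrm (grad l (X n)) ^ q = Υ ^ q := by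
    rw [hΥ, ← Real.rpow_mul, one_div_mul_cancel hq0.ne', Real.rpow_one]
    exact mul_nonneg (by positivity) (Finset.sum_nonneg fun n _ => Real.rpow_nonneg (hg0 n) q)
  subst hμ
  set A₀ : ℝ := 1 / (N : ℝ) * ∑ n, l (X n) with hA₀
  set A : ℝ → ℝ := fun δ => 1 / (N : ℝ) * ∑ n, l (Xhat δ n) with hA
  have hupper := fun ε hε =>
    exists_integral_le_of_Wp_le hN hpq' hnrm hlip hd X hΥpos hΥq (ε := ε) hε
  have hexp : (q - 1) * p = q := by linear_combination hpq'.symm.sub_one_mul_conj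
  have hWp : ∀ δ > 0, Wp p nrm ((N : ℝ≥0∞)⁻¹ • ∑ n, Measure.dirac (X n))
      ((N : ℝ≥0∞)⁻¹ • ∑ n, Measure.dirac (Xhat δ n)) ≤ ENNReal.ofReal δ := by
    intro δ hδ
    refine (Wp_empirical_le hN hp0 hnrm _ _).trans_eq ?_
    have hterm : ∀ n, nrm (X n - Xhat δ n) ^ p =
        δ ^ p * (Υ ^ q)⁻¹ * dualNorm nrm (grad l (X n)) ^ q := by
      intro n
      have h1 : nrm (X n - Xhat δ n) =
          δ * dualNorm nrm (grad l (X n)) ^ (q - 1) * Υ ^ (1 - q) := by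
        rw [hnrm.map_sub_rev, hXhat, add_sub_cancel_left, hnrm.smul]
        by_cases h0 : grad l (X n) = 0
        · rw [h0, hnrm.dualNorm_zero, Real.zero_rpow (by linarith)]
          simp
        · rw [hunit _ h0, mul_one, abs_of_nonneg]
          have := hg0 n
          positivity
      have := hg0 n
      rw [h1, Real.mul_rpow (by positivity) (by positivity),
        Real.mul_rpow (by positivity) (by positivity), ← Real.rpow_mul this,
        ← Real.rpow_mul hΥpos.le, hexp, ← Real.rpow_neg hΥpos.le,
        show (1 - q) * p = -q by linear_combination -hexp]
      ring
    simp_rw [hterm]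
    rw [← Finset.mul_sum, mul_left_comm, hΥq, mul_assoc, inv_mul_cancel₀ (by positivity), mul_one,
      ← Real.rpow_mul hδ.le, mul_one_div_cancel hp0.ne', Real.rpow_one]
  have hmem : ∀ δ > 0, A δ ∈ {r | ∃ η : Measure (Fin k → ℝ), IsProbabilityMeasure η ∧
      Wp p nrm ((N : ℝ≥0∞)⁻¹ • ∑ n, Measure.dirac (X n)) η ≤ ENNReal.ofReal δ ∧
      r = ∫ x, l x ∂η} := fun δ hδ =>
    ⟨_, isProbabilityMeasure_empirical hN (Xhat δ), hWp δ hδ, (integral_empirical _ _).symm⟩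
  have hlower : ∀ δ > 0, A δ ≤ Vrob p nrm l ((N : ℝ≥0∞)⁻¹ • ∑ n, Measure.dirac (X n)) δ := by
    intro δ hδ
    obtain ⟨C, hC⟩ := hupper 1 one_pos
    refine le_csSup ⟨A₀ + (Υ + 1) * δ + C * δ ^ p, ?_⟩ (hmem δ hδ)
    rintro r ⟨η, -, hη, rfl⟩
    exact hC δ hδ η hη
  have hderiv : Tendsto (fun δ : ℝ => (A δ - A₀) / δ) (nhdsWithin 0 (Set.Ioi 0)) (nhds Υ) := by
    have hterm : ∀ n, HasDerivAt (fun δ => l (Xhat δ n))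
        (Υ ^ (1 - q) * dualNorm nrm (grad l (X n)) ^ q) 0 := by
      intro n
      set v := (dualNorm nrm (grad l (X n)) ^ (q - 1) * Υ ^ (1 - q)) • h (grad l (X n)) with hv
      have hX : (fun δ => l (Xhat δ n)) = fun δ : ℝ => l (X n + δ • v) := by
        funext δ
        rw [hXhat, hv, smul_smul, mul_assoc]
      have hval : Υ ^ (1 - q) * dualNorm nrm (grad l (X n)) ^ q = fderiv ℝ l (X n) v := by
        rw [hv, map_smul, fderiv_apply_eq_pairing, hdual, smul_eq_mul]
        nth_rewrite 3 [← Real.rpow_one (dualNorm nrm (grad l (X n)))]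
        rw [mul_right_comm, ← Real.rpow_add_of_nonneg (hg0 n) (by linarith) zero_le_one,
          sub_add_cancel, mul_comm]
      rw [hX, hval]
      exact (hd (X n)).hasFDerivAt.hasLineDerivAt v
    have hsum : HasDerivAt A Υ 0 := by
      have h1 := (HasDerivAt.fun_sum fun n (_ : n ∈ Finset.univ) => hterm n).const_mul
        (1 / (N : ℝ))
      rwa [← Finset.mul_sum, mul_left_comm, hΥq, ← Real.rpow_add hΥpos, sub_add_cancel,
        Real.rpow_one] at h1
    have hA0 : A 0 = A₀ := by simp [hA, hA₀, hXhat]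
    refine (hsum.tendsto_slope_zero_right).congr fun δ => ?_
    rw [zero_add, hA0, smul_eq_mul, inv_mul_eq_div]
  refine Metric.tendsto_nhds.2 fun ε hε => ?_
  obtain ⟨C, hC⟩ := hupper (ε / 2) (half_pos hε)
  have hlim : Tendsto (fun δ : ℝ => Υ + ε / 2 + C * δ ^ (p - 1) - (A δ - A₀) / δ)
      (nhdsWithin 0 (Set.Ioi 0)) (nhds (ε / 2)) := by
    have h1 : Tendsto (fun δ : ℝ => δ ^ (p - 1)) (nhdsWithin 0 (Set.Ioi 0)) (nhds 0) := by
      have := (Real.continuousAt_rpow_const 0 (p - 1) (Or.inr (by linarith))).tendsto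
      rw [Real.zero_rpow (by linarith)] at this
      exact this.mono_left nhdsWithin_le_nhds
    have h2 := ((h1.const_mul C).const_add (Υ + ε / 2)).sub hderiv
    convert h2 using 2
    ring
  filter_upwards [hlim.eventually_lt_const (half_lt_self hε), self_mem_nhdsWithin] with δ hlt hδ
  have hδ : 0 < δ := hδ
  have hV : Vrob p nrm l ((N : ℝ≥0∞)⁻¹ • ∑ n, Measure.dirac (X n)) δ ≤
      A₀ + (Υ + ε / 2) * δ + C * δ ^ p := by
    refine csSup_le ⟨_, hmem δ hδ⟩ ?_
    rintro r ⟨η, -, hη, rfl⟩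
    exact hC δ hδ η hη
  rw [Real.dist_eq, sub_zero, abs_of_nonneg (div_nonneg (sub_nonneg.2 (hlower δ hδ)) hδ.le)]
  refine lt_of_le_of_lt ?_ hlt
  have hpow : δ ^ p = δ ^ (p - 1) * δ := by
    rw [← Real.rpow_add_one hδ.ne', sub_add_cancel]
  rw [div_le_iff₀ hδ, sub_mul, div_mul_cancel₀ _ hδ.ne']
  rw [hpow] at hV
  linarith
end
end

section
/- Let p, q ∈ (1, ∞) be conjugate exponents (1/p + 1/q = 1) and λ_1, …, λ_d > 0. On E = (ℝ^m)^d define the mixture norm ‖x‖ = (Σ_{i=1}^d (λ_i ‖x^i‖_∞)^p)^{1/p} and the pairing ⟨x, y⟩ = Σ_{i=1}^d ⟨x^i, y^i⟩. Then the dual norm of ‖·‖ is given by sup { ⟨x, y⟩ : x ∈ E, ‖x‖ ≤ 1 } = (Σ_{i=1}^d (λ_i^{−1} ‖y^i‖_1)^q)^{1/q} for every y ∈ E. -/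
noncomputable section

/-- The componentwise sign function on `ℝ^m`. -/
def signv {m : ℕ} (x : Fin m → ℝ) : Fin m → ℝ := fun i => Real.sign (x i)

/-- The `ℓ¹`-norm on `ℝ^m`. -/
def l1norm {m : ℕ} (x : Fin m → ℝ) : ℝ := ∑ i, |x i|

/-- The sup-norm on `ℝ^m`. -/
def linfnorm {m : ℕ} (x : Fin m → ℝ) : ℝ := ⨆ i, |x i|

/-- The standard inner product pairing on `ℝ^m`. -/
def pairR {m : ℕ} (x y : Fin m → ℝ) : ℝ := ∑ i, x i * y i

/-- The mixture norm `‖x‖ = (Σ_i (λ_i ‖x^i‖_∞)^p)^{1/p}` on `E = (ℝ^m)^d`. -/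
def mixNorm {m d : ℕ} (p : ℝ) (lam : Fin d → ℝ) (x : Fin d → Fin m → ℝ) : ℝ :=
  (∑ i, (lam i * linfnorm (x i)) ^ p) ^ (1 / p)

/-- The dual mixture norm `‖y‖_* = (Σ_i (λ_i⁻¹ ‖y^i‖_1)^q)^{1/q}` on `E = (ℝ^m)^d`. -/
def mixDual {m d : ℕ} (q : ℝ) (lam : Fin d → ℝ) (y : Fin d → Fin m → ℝ) : ℝ :=
  (∑ i, ((lam i)⁻¹ * l1norm (y i)) ^ q) ^ (1 / q)

/-- The pairing `⟨x, y⟩ = Σ_i ⟨x^i, y^i⟩` on `E = (ℝ^m)^d`. -/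
def pairE {m d : ℕ} (x y : Fin d → Fin m → ℝ) : ℝ := ∑ i, pairR (x i) (y i)

/-- The blockwise duality map
`h(y)^i = ‖y‖_*^{1-q} · λ_i⁻¹ sign(y^i) (λ_i⁻¹ ‖y^i‖_1)^{q-1}`. -/
def hmix {m d : ℕ} (q : ℝ) (lam : Fin d → ℝ) (y : Fin d → Fin m → ℝ) :
    Fin d → Fin m → ℝ :=
  fun i =>
    (mixDual q lam y ^ (1 - q) * (lam i)⁻¹ * ((lam i)⁻¹ * l1norm (y i)) ^ (q - 1)) •
      signv (y i)

theorem abs_le_linfnorm {m : ℕ} (x : Fin m → ℝ) (j : Fin m) : |x j| ≤ linfnorm x :=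
  le_ciSup (f := fun j => |x j|) (Set.finite_range _).bddAbove j

theorem linfnorm_nonneg {m : ℕ} (x : Fin m → ℝ) : 0 ≤ linfnorm x :=
  Real.iSup_nonneg fun _ => abs_nonneg _

theorem l1norm_nonneg {m : ℕ} (x : Fin m → ℝ) : 0 ≤ l1norm x :=
  Finset.sum_nonneg fun _ _ => abs_nonneg _

theorem pairR_le_linfnorm_mul_l1norm {m : ℕ} (x y : Fin m → ℝ) :
    pairR x y ≤ linfnorm x * l1norm y := by
  unfold pairR l1norm
  rw [Finset.mul_sum]
  refine Finset.sum_le_sum fun j _ => (le_abs_self _).trans ?_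
  rw [abs_mul]
  exact mul_le_mul_of_nonneg_right (abs_le_linfnorm x j) (abs_nonneg _)

theorem linfnorm_smul_signv_le {m : ℕ} {c : ℝ} (hc : 0 ≤ c) (y : Fin m → ℝ) :
    linfnorm (c • signv y) ≤ c := by
  refine Real.iSup_le (fun j => ?_) hc
  have h : |Real.sign (y j)| ≤ 1 := by
    rcases Real.sign_apply_eq (y j) with h | h | h <;> simp [h]
  simpa [signv, abs_mul, abs_of_nonneg hc] using mul_le_mul_of_nonneg_left h hc

theorem pairR_smul_signv {m : ℕ} (c : ℝ) (y : Fin m → ℝ) :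
    pairR (c • signv y) y = c * l1norm y := by
  unfold pairR l1norm
  rw [Finset.mul_sum]
  refine Finset.sum_congr rfl fun j _ => ?_
  have h : Real.sign (y j) * y j = |y j| := by
    rcases lt_trichotomy (y j) 0 with h | h | h
    · simp [Real.sign_of_neg h, abs_of_neg h]
    · simp [h]
    · simp [Real.sign_of_pos h, abs_of_pos h]
  simp [signv, mul_assoc, h]

/-- Hölder's inequality for the mixture norm. -/
theorem pairE_le_mixNorm_mul_mixDual {m d : ℕ} {p q : ℝ} (hpq : p.HolderConjugate q)
    {lam : Fin d → ℝ} (hlam : ∀ i, 0 < lam i) (x y : Fin d → Fin m → ℝ) :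
    pairE x y ≤ mixNorm p lam x * mixDual q lam y := by
  refine le_trans (Finset.sum_le_sum fun i _ => ?_)
    (Real.inner_le_Lp_mul_Lq_of_nonneg Finset.univ hpq
      (fun i _ => mul_nonneg (hlam i).le (linfnorm_nonneg (x i)))
      (fun i _ => mul_nonneg (inv_nonneg.2 (hlam i).le) (l1norm_nonneg (y i))))
  refine (pairR_le_linfnorm_mul_l1norm (x i) (y i)).trans_eq ?_
  have := (hlam i).ne'
  field_simp

/-- The dual mixture norm is attained on the unit ball of the mixture norm. -/
theorem exists_mixNorm_le_one_pairE_eq_mixDual {m d : ℕ} {p q : ℝ} (hpq : p.HolderConjugate q)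
    {lam : Fin d → ℝ} (hlam : ∀ i, 0 < lam i) (y : Fin d → Fin m → ℝ) :
    ∃ x : Fin d → Fin m → ℝ, mixNorm p lam x ≤ 1 ∧ pairE x y = mixDual q lam y := by
  have hf : ∀ i, 0 ≤ (lam i)⁻¹ * l1norm (y i) := fun i =>
    mul_nonneg (inv_nonneg.2 (hlam i).le) (l1norm_nonneg (y i))
  obtain ⟨g, hg, hsum⟩ := (NNReal.isGreatest_Lp Finset.univ
    (fun i => (⟨(lam i)⁻¹ * l1norm (y i), hf i⟩ : NNReal)) hpq.symm).1
  have hg' : ∑ i, (g i : ℝ) ^ p ≤ 1 := by exact_mod_cast hg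
  have hsum' := congrArg ((↑) : NNReal → ℝ) hsum
  push_cast at hsum'
  have hc : ∀ i, 0 ≤ (lam i)⁻¹ * (g i : ℝ) := fun i =>
    mul_nonneg (inv_nonneg.2 (hlam i).le) (g i).2
  have hn : ∀ i, 0 ≤ lam i * linfnorm (((lam i)⁻¹ * (g i : ℝ)) • signv (y i)) := fun i =>
    mul_nonneg (hlam i).le (linfnorm_nonneg _)
  refine ⟨fun i => ((lam i)⁻¹ * (g i : ℝ)) • signv (y i), ?_, ?_⟩
  · refine Real.rpow_le_one (Finset.sum_nonneg fun i _ => Real.rpow_nonneg (hn i) _)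
      (le_trans (Finset.sum_le_sum fun i _ => ?_) hg') (one_div_nonneg.2 hpq.nonneg)
    refine Real.rpow_le_rpow (hn i) ?_ hpq.nonneg
    calc lam i * linfnorm (((lam i)⁻¹ * (g i : ℝ)) • signv (y i))
        ≤ lam i * ((lam i)⁻¹ * (g i : ℝ)) :=
          mul_le_mul_of_nonneg_left (linfnorm_smul_signv_le (hc i) _) (hlam i).le
      _ = g i := mul_inv_cancel_left₀ (hlam i).ne' _
  · refine Eq.trans (Finset.sum_congr rfl fun i _ => ?_) hsum'
    rw [pairR_smul_signv]
    change (lam i)⁻¹ * (g i : ℝ) * l1norm (y i) = (lam i)⁻¹ * l1norm (y i) * (g i : ℝ)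
    ring

theorem stmt11 {m d : ℕ} (p q : ℝ) (hp : 1 < p) (hq : 1 < q) (hpq : 1 / p + 1 / q = 1)
    (lam : Fin d → ℝ) (hlam : ∀ i, 0 < lam i) (y : Fin d → Fin m → ℝ) :
    sSup {r | ∃ x : Fin d → Fin m → ℝ, mixNorm p lam x ≤ 1 ∧ r = pairE x y} =
      mixDual q lam y := by
  have hc : p.HolderConjugate q :=
    Real.holderConjugate_iff.2 ⟨hp, by simpa only [one_div] using hpq⟩
  obtain ⟨x, hx, hxy⟩ := exists_mixNorm_le_one_pairE_eq_mixDual hc hlam y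
  refine IsGreatest.csSup_eq ⟨⟨x, hx, hxy.symm⟩, ?_⟩
  rintro _ ⟨z, hz, rfl⟩
  have hy : 0 ≤ mixDual q lam y :=
    Real.rpow_nonneg (Finset.sum_nonneg fun i _ => Real.rpow_nonneg
      (mul_nonneg (inv_nonneg.2 (hlam i).le) (l1norm_nonneg (y i))) _) _
  exact (pairE_le_mixNorm_mul_mixDual hc hlam z y).trans (mul_le_of_le_one_left hy hz)
end
end
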